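/- arXiv:1412.3936 — 3 statements merged into one kernel-verified Lean document; each statement's English description precedes it below -/
import Mathlib

section
/- Suppose K ⊆ ℝ is a cubic field (a degree-3 extension of ℚ) having exactly one real embedding, and let α, β ∈ K. Then there exists a Peck sequence for the pair (α, β); that is, there exist a strictly increasing sequence {sₙ} of positive integers, real constants M₁, M₂ > 0, and a strictly increasing function j : ℕ → ℕ such that, writing ψₙ = s_{j(n)} (so ψₙ ≥ 2), for all n one has max{‖sₙ·α‖, ‖sₙ·β‖} < M₁/√sₙ and ‖ψₙ·α‖ < M₂/(√ψₙ · log ψₙ). -/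
/-- Distance from a real number to the nearest integer. -/
noncomputable def distNearestInt (x : ℝ) : ℝ := |x - round x|

open NumberField

theorem distNearestInt_le (x : ℝ) (a : ℤ) : distNearestInt x ≤ |x - a| :=
  round_le x a

/-- An irrational number has Dirichlet approximations of arbitrarily large denominator. -/
theorem exists_rat_abs_sub_lt_of_irrational {θ : ℝ} (hθ : Irrational θ) (N : ℕ) :
    ∃ q : ℚ, N ≤ q.den ∧ |θ - q| < 1 / (q.den : ℝ) ^ 2 := by
  by_contra! h
  refine Real.infinite_rat_abs_sub_lt_one_div_den_sq_of_irrational hθ ?_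
  let B : ℤ := ⌈(|θ| + 1) * N⌉
  have hfin : ((Set.Icc (-B) B) ×ˢ (Set.Icc 0 N)).Finite :=
    (Set.finite_Icc _ _).prod (Set.finite_Icc _ _)
  refine Set.Finite.of_finite_image (f := fun q : ℚ ↦ (q.num, q.den)) (hfin.subset ?_) ?_
  · rintro _ ⟨q, hq, rfl⟩
    have hqN : q.den < N := by
      by_contra! hN
      exact absurd (h q hN) (not_le.2 hq)
    have hden : (1 : ℝ) ≤ q.den := by exact_mod_cast q.den_pos
    have hlt : |θ - q| < 1 := hq.trans_le (by
      rw [div_le_one (by positivity)]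
      exact one_le_pow₀ hden)
    have hqabs : |(q : ℝ)| ≤ |θ| + 1 := by
      have := abs_sub_abs_le_abs_sub (q : ℝ) θ
      rw [abs_sub_comm] at this
      linarith
    have hnum : (q.num : ℝ) = q * q.den := by
      exact_mod_cast (Rat.mul_den_eq_num q).symm
    have hle : |(q.num : ℝ)| ≤ B := by
      rw [hnum, abs_mul, Nat.abs_cast]
      refine le_trans ?_ (Int.le_ceil _)
      have : (q.den : ℝ) ≤ N := by exact_mod_cast hqN.le
      gcongr
    rw [abs_le] at hle
    simp only [Set.mem_prod, Set.mem_Icc]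
    exact ⟨⟨by exact_mod_cast hle.1, by exact_mod_cast hle.2⟩, Nat.zero_le _, hqN.le⟩
  · intro a _ b _ hab
    simp only [Prod.mk.injEq] at hab
    exact Rat.ext hab.1 hab.2

/-- Inhomogeneous Diophantine approximation for an irrational rotation. -/
theorem exists_abs_mul_sub_sub_le_of_irrational {θ : ℝ} (hθ : Irrational θ) (φ : ℝ) (N : ℕ) :
    ∃ n : ℕ, N ≤ n ∧ 0 < n ∧ ∃ m : ℤ, |n * θ - φ - m| ≤ 5 / n := by
  obtain ⟨q, hqN, hq⟩ := exists_rat_abs_sub_lt_of_irrational hθ N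
  set Q := q.den with hQ
  have hQpos : 0 < Q := q.den_pos
  have hQposR : (0 : ℝ) < Q := by exact_mod_cast hQpos
  have hcop : IsCoprime q.num (Q : ℤ) := Rat.isCoprime_num_den q
  obtain ⟨a, b, hab⟩ := hcop
  set c := round (Q * φ)
  let r : ℤ := (a * c) % Q
  have hr0 : 0 ≤ r := Int.emod_nonneg _ (by omega)
  have hrQ : r < Q := Int.emod_lt_of_pos _ (by omega)
  have hr : a * c = Q * (a * c / Q) + r := (Int.mul_ediv_add_emod _ _).symm
  obtain ⟨k, hk⟩ : ∃ k : ℤ, (Q + r) * q.num = c + Q * k :=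
    ⟨q.num - b * c - a * c / Q * q.num, by linear_combination -q.num * hr + c * hab⟩
  refine ⟨Q + r.toNat, by omega, by omega, k, ?_⟩
  have hn : ((Q + r.toNat : ℕ) : ℝ) = Q + r := by
    have : ((r.toNat : ℤ) : ℝ) = r := by rw [Int.toNat_of_nonneg hr0]
    rw [← this, Int.cast_natCast, Nat.cast_add]
  rw [hn]
  have hr0' : (0 : ℝ) ≤ r := by exact_mod_cast hr0
  have hrQ' : (r : ℝ) ≤ Q := by exact_mod_cast hrQ.le
  have hk' : ((Q : ℝ) + r) * q.num = c + Q * k := by exact_mod_cast hk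
  have hnum : (q.num : ℝ) = q * Q := by
    exact_mod_cast (Rat.mul_den_eq_num q).symm
  have hc : |(Q : ℝ) * φ - c| ≤ 1 / 2 := abs_sub_round _
  have key : ((Q : ℝ) + r) * θ - φ - k
      = (Q + r) * (θ - q) - (Q * φ - c) / Q := by
    rw [hnum] at hk'
    field_simp
    linear_combination hk'
  rw [key]
  calc |((Q : ℝ) + r) * (θ - q) - (Q * φ - c) / Q|
      ≤ |((Q : ℝ) + r) * (θ - q)| + |(Q * φ - c) / Q| := abs_sub _ _
    _ ≤ (2 * Q) * (1 / (Q : ℝ) ^ 2) + (1 / 2) / Q := by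
        rw [abs_mul, abs_div, abs_of_pos hQposR, abs_of_nonneg (by positivity : (0 : ℝ) ≤ Q + r)]
        gcongr
        linarith
    _ = 5 / (2 * Q) := by field_simp; norm_num
    _ ≤ 5 / (Q + r) := by gcongr; linarith

/-- If no positive power of `ω` is real, then `z * ω ^ n` is infinitely often nearly imaginary. -/
theorem exists_abs_re_mul_pow_le {ω : ℂ} (hω : ∀ n : ℕ, 0 < n → (ω ^ n).im ≠ 0) (z : ℂ) (N : ℕ) :
    ∃ n : ℕ, N ≤ n ∧ 0 < n ∧ |(z * ω ^ n).re| ≤ ‖z‖ * ‖ω‖ ^ n * (5 * Real.pi / n) := by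
  have hpi := Real.pi_pos
  have hpow (n : ℕ) : ω ^ n = ((‖ω‖ ^ n : ℝ) : ℂ) * Complex.exp ((n * ω.arg : ℝ) * Complex.I) := by
    conv_lhs => rw [← Complex.norm_mul_exp_arg_mul_I ω]
    rw [mul_pow, ← Complex.exp_nat_mul]
    push_cast
    ring_nf
  have hirr : Irrational (ω.arg / Real.pi) := by
    rintro ⟨q, hq⟩
    apply hω q.den q.den_pos
    have : (q.den : ℝ) * ω.arg = q.num * Real.pi := by
      have hnum : (q.num : ℝ) = q * q.den := by
        exact_mod_cast (Rat.mul_den_eq_num q).symm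
      rw [hnum, hq]
      field_simp
    rw [hpow, this, Complex.im_ofReal_mul, Complex.exp_ofReal_mul_I_im, Real.sin_int_mul_pi,
      mul_zero]
  obtain ⟨n, hN, hn, m, hm⟩ :=
    exists_abs_mul_sub_sub_le_of_irrational hirr (1 / 2 - z.arg / Real.pi) N
  refine ⟨n, hN, hn, ?_⟩
  set δ := n * (ω.arg / Real.pi) - (1 / 2 - z.arg / Real.pi) - m with hδ
  have hangle : z.arg + n * ω.arg = (Real.pi * δ + Real.pi / 2) + m * Real.pi := by
    rw [hδ]
    field_simp
    ring
  have hz : z * ω ^ n = ((‖z‖ * ‖ω‖ ^ n : ℝ) : ℂ) *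
      Complex.exp ((z.arg + n * ω.arg : ℝ) * Complex.I) := by
    conv_lhs => rw [hpow, ← Complex.norm_mul_exp_arg_mul_I z]
    push_cast
    rw [add_mul, Complex.exp_add]
    ring
  rw [hz, Complex.re_ofReal_mul, Complex.exp_ofReal_mul_I_re, hangle, Real.cos_add_int_mul_pi,
    Real.cos_add_pi_div_two, abs_mul, abs_of_nonneg (by positivity)]
  gcongr
  rw [abs_mul, abs_neg, abs_zpow, abs_neg, abs_one, one_zpow, one_mul]
  calc |Real.sin (Real.pi * δ)| ≤ |Real.pi * δ| := Real.abs_sin_le_abs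
    _ = Real.pi * |δ| := by rw [abs_mul, abs_of_pos hpi]
    _ ≤ Real.pi * (5 / n) := by gcongr
    _ = 5 * Real.pi / n := by ring

section CubicField

variable {K : Type*} [Field K] [NumberField K]

/-- A cubic field with a unique real embedding `ι` has a non-real complex embedding `σ`, and the
complex embeddings are exactly `ι`, `σ` and the conjugate of `σ`. -/
theorem exists_complexEmbedding_of_cubic (hdeg : Module.finrank ℚ K = 3) {ι : K →+* ℝ}
    (hι : ∀ f : K →+* ℝ, f = ι) :
    ∃ σ : K →+* ℂ, ComplexEmbedding.conjugate σ ≠ σ ∧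
      ∀ F : (K →+* ℂ) → ℂ, (∑ τ, F τ = F (Complex.ofRealHom.comp ι) + F σ +
        F (ComplexEmbedding.conjugate σ)) ∧ (∏ τ, F τ = F (Complex.ofRealHom.comp ι) * F σ *
        F (ComplexEmbedding.conjugate σ)) := by
  classical
  have hcard : Fintype.card (K →+* ℂ) = 3 := by rw [Embeddings.card, hdeg]
  have : Nontrivial (K →+* ℂ) := Fintype.one_lt_card_iff_nontrivial.1 (by omega)
  obtain ⟨σ, hσ⟩ := exists_ne (Complex.ofRealHom.comp ι)
  have hreal : ComplexEmbedding.conjugate (Complex.ofRealHom.comp ι) =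
      Complex.ofRealHom.comp ι := by
    ext x
    simp
  have hconj : ComplexEmbedding.conjugate σ ≠ σ := by
    intro h
    apply hσ
    have hr : ComplexEmbedding.IsReal σ := h
    ext x
    rw [← hr.coe_embedding_apply x, hι hr.embedding]
    rfl
  have hconj' : ComplexEmbedding.conjugate σ ≠ Complex.ofRealHom.comp ι := by
    intro h
    apply hσ
    rw [← hreal, ← h]
    ext x
    simp
  refine ⟨σ, hconj, fun F ↦ ?_⟩
  have huniv : (Finset.univ : Finset (K →+* ℂ)) =
      {Complex.ofRealHom.comp ι, σ, ComplexEmbedding.conjugate σ} := by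
    symm
    rw [← Finset.card_eq_iff_eq_univ, hcard, Finset.card_eq_three]
    exact ⟨_, _, _, hσ.symm, hconj'.symm, hconj.symm, rfl⟩
  have h1 : Complex.ofRealHom.comp ι ∉ ({σ, ComplexEmbedding.conjugate σ} : Finset (K →+* ℂ)) := by
    simp [hσ.symm, hconj'.symm]
  have h2 : σ ∉ ({ComplexEmbedding.conjugate σ} : Finset (K →+* ℂ)) := by
    simpa using hconj.symm
  rw [huniv, Finset.sum_insert h1, Finset.sum_insert h2, Finset.sum_singleton,
    Finset.prod_insert h1, Finset.prod_insert h2, Finset.prod_singleton, add_assoc, mul_assoc]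
  exact ⟨rfl, rfl⟩

/-- In a field of prime degree, only rational elements have the same image under two distinct
embeddings. -/
theorem mem_range_algebraMap_of_embeddings_eq (hdeg : (Module.finrank ℚ K).Prime) {σ τ : K →+* ℂ}
    (hne : σ ≠ τ) {x : K} (hx : σ x = τ x) : x ∈ Set.range (algebraMap ℚ K) := by
  have := IntermediateField.isSimpleOrder_of_finrank_prime ℚ K hdeg
  let L : IntermediateField ℚ K :=
    { AlgHom.equalizer σ.toRatAlgHom τ.toRatAlgHom with
      inv_mem' := fun y hy ↦ by
        have hy' : σ y = τ y := hy
        show σ y⁻¹ = τ y⁻¹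
        rw [map_inv₀, map_inv₀, hy'] }
  have hmem (y : K) : y ∈ L ↔ σ y = τ y := Iff.rfl
  rcases eq_bot_or_eq_top L with h | h
  · have : x ∈ L := (hmem x).2 hx
    rw [h] at this
    exact IntermediateField.mem_bot.1 this
  · refine absurd (RingHom.ext fun y ↦ (hmem y).1 ?_) hne
    rw [h]
    exact IntermediateField.mem_top

/-- The data on a cubic field with a unique real embedding needed for approximation: a non-real
embedding, the integrality of traces, and an
expanding unit no positive power of which has real image under that embedding. -/
theorem exists_expanding_unit_of_cubic (hdeg : Module.finrank ℚ K = 3) {ι : K →+* ℝ}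
    (hι : ∀ f : K →+* ℝ, f = ι) :
    ∃ (σ : K →+* ℂ) (u : K), IsIntegral ℤ u ∧ 1 < ι u ∧ ι u * ‖σ u‖ ^ 2 = 1 ∧
      (∀ n : ℕ, 0 < n → ((σ u) ^ n).im ≠ 0) ∧
      ∀ x : K, IsIntegral ℤ x → ∃ a : ℤ, (a : ℝ) = ι x + 2 * (σ x).re := by
  obtain ⟨σ, hconj, hF⟩ := exists_complexEmbedding_of_cubic hdeg hι
  have htrace (x : K) : ((Algebra.trace ℚ K x : ℚ) : ℝ) = ι x + 2 * (σ x).re := by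
    have h := trace_eq_sum_embeddings (K := ℚ) (L := K) ℂ (x := x)
    rw [← Equiv.sum_comp (RingHom.equivRatAlgHom (R := K) (S := ℂ))] at h
    have h' := h.trans (hF (fun τ ↦ τ x)).1
    have := congrArg Complex.re h'
    simp at this
    linarith
  have hnorm (x : K) : ((Algebra.norm ℚ x : ℚ) : ℝ) = ι x * ‖σ x‖ ^ 2 := by
    have h := Algebra.norm_eq_prod_embeddings ℚ ℂ x
    rw [← Equiv.prod_comp (RingHom.equivRatAlgHom (R := K) (S := ℂ))] at h
    have h' := h.trans (hF (fun τ ↦ τ x)).2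
    apply Complex.ofReal_injective
    simp only [ComplexEmbedding.conjugate_coe_eq, mul_assoc, Complex.mul_conj'] at h'
    simpa using h'
  have hplace : InfinitePlace.mk σ ≠ InfinitePlace.mk (Complex.ofRealHom.comp ι) := by
    intro h
    have hreal : ComplexEmbedding.IsReal (Complex.ofRealHom.comp ι) := by
      ext x
      simp
    rcases InfinitePlace.mk_eq_iff.1 h with h | h
    · exact hconj (by rw [h]; exact hreal)
    · apply hconj
      have : ComplexEmbedding.IsReal (ComplexEmbedding.conjugate σ) := h ▸ hreal
      exact ComplexEmbedding.isReal_conjugate_iff.1 this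
  obtain ⟨v, hv⟩ := Units.dirichletUnitTheorem.exists_unit K
    (InfinitePlace.mk (Complex.ofRealHom.comp ι))
  have hv := hv _ hplace
  set w : K := algebraMap (𝓞 K) K v with hw
  have hw0 : w ≠ 0 := by simp [hw]
  have hσpos : 0 < ‖σ w‖ := by simpa using hw0
  have hσlt : ‖σ w‖ < 1 := by
    rw [InfinitePlace.apply] at hv
    by_contra! h
    exact absurd (Real.log_nonneg h) (not_le.2 hv)
  have hprod : |ι w| * ‖σ w‖ ^ 2 = 1 := by
    have h := Units.norm K v
    have h2 := congrArg (fun t : ℚ ↦ (t : ℝ)) h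
    simp only [Rat.cast_abs, Rat.cast_one] at h2
    rw [hnorm, abs_mul, abs_of_pos (pow_pos hσpos 2)] at h2
    exact h2
  have hιsq : ι (w ^ 2) = |ι w| ^ 2 := by rw [map_pow, sq_abs]
  have hιw : 1 < |ι w| := by
    by_contra! h
    have : ‖σ w‖ ^ 2 < 1 := pow_lt_one₀ hσpos.le hσlt two_ne_zero
    nlinarith [abs_nonneg (ι w)]
  have hι1 : 1 < ι (w ^ 2) := by
    rw [hιsq]
    exact one_lt_pow₀ hιw two_ne_zero
  refine ⟨σ, w ^ 2, (RingOfIntegers.isIntegral_coe _).pow 2, hι1, ?_, ?_, ?_⟩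
  · rw [hιsq, map_pow, norm_pow, ← pow_mul, mul_comm 2 2, pow_mul, ← mul_pow, hprod, one_pow]
  · intro n hn him
    have hx : ComplexEmbedding.conjugate σ ((w ^ 2) ^ n) = σ ((w ^ 2) ^ n) := by
      rw [ComplexEmbedding.conjugate_coe_eq, Complex.conj_eq_iff_im, map_pow, him]
    obtain ⟨r, hr⟩ := mem_range_algebraMap_of_embeddings_eq (by rw [hdeg]; norm_num) hconj hx
    have h1 : ι ((w ^ 2) ^ n) = r := by rw [← hr]; simp
    have h2 : ‖σ ((w ^ 2) ^ n)‖ = |(r : ℝ)| := by rw [← hr]; simp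
    have h3 : 1 < (r : ℝ) := by
      rw [← h1, map_pow]
      exact one_lt_pow₀ hι1 hn.ne'
    have h4 : |(r : ℝ)| < 1 := by
      rw [← h2, map_pow, map_pow, norm_pow, norm_pow, ← pow_mul]
      exact pow_lt_one₀ hσpos.le hσlt (by positivity)
    linarith [le_abs_self (r : ℝ)]
  · intro x hx
    obtain ⟨a, ha⟩ := IsIntegrallyClosed.isIntegral_iff.1
      (Algebra.isIntegral_trace (R := ℤ) (L := ℚ) hx)
    refine ⟨a, ?_⟩
    rw [← htrace, ← ha]
    simp

end CubicField

/-- Any two elements of a number field have a common positive integral denominator. -/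
theorem exists_pos_isIntegral_mul {K : Type*} [Field K] [NumberField K] (x y : K) :
    ∃ d : ℤ, 0 < d ∧ IsIntegral ℤ ((d : K) * x) ∧ IsIntegral ℤ ((d : K) * y) := by
  have hden (t : K) : ∃ m : ℤ, m ≠ 0 ∧ IsIntegral ℤ ((m : K) * t) := by
    obtain ⟨m, hm⟩ := IsIntegral.exists_multiple_integral_of_isLocalization
      (nonZeroDivisors ℤ) (Rₘ := ℚ) t (Algebra.IsIntegral.isIntegral t)
    refine ⟨m, nonZeroDivisors.coe_ne_zero m, ?_⟩
    rwa [Submonoid.smul_def, zsmul_eq_mul] at hm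
  obtain ⟨m, hm0, hm⟩ := hden x
  obtain ⟨k, hk0, hk⟩ := hden y
  have hintegral (z : ℤ) : IsIntegral ℤ (z : K) := isIntegral_algebraMap (R := ℤ) (x := z)
  refine ⟨(m * k) ^ 2, by positivity, ?_, ?_⟩
  · have h : (((m * k) ^ 2 : ℤ) : K) * x = ((m * k ^ 2 : ℤ) : K) * (m * x) := by
      push_cast
      ring
    exact h ▸ (hintegral _).mul hm
  · have h : (((m * k) ^ 2 : ℤ) : K) * y = ((m ^ 2 * k : ℤ) : K) * (k * y) := by
      push_cast
      ring
    exact h ▸ (hintegral _).mul hk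

/-- If `Q = d * (ε ^ n + 2 * Re (ω ^ n))` with `ε * ‖ω‖ ^ 2 = 1`, then `Q` is comparable to
`‖ω‖ ^ (-2 * n)`. -/
theorem norm_pow_le_div_sqrt {ε d Q : ℝ} {ω : ℂ} (hε : 1 < ε) (hεω : ε * ‖ω‖ ^ 2 = 1)
    (hd : 1 ≤ d) (n : ℕ) (hQ : Q = d * (ε ^ n + 2 * (ω ^ n).re)) (hεn : 4 ≤ ε ^ n) :
    ε ^ n - 2 ≤ Q ∧ Q ≤ 3 * d * ε ^ n ∧ ‖ω‖ ^ n ≤ √(3 * d) / √Q := by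
  have hω1 : ‖ω‖ ^ n ≤ 1 := by
    refine pow_le_one₀ (norm_nonneg _) ?_
    by_contra! h
    nlinarith [norm_nonneg ω]
  have hre : |(ω ^ n).re| ≤ 1 := (Complex.abs_re_le_norm _).trans (by rwa [norm_pow])
  rw [abs_le] at hre
  have hle : Q ≤ 3 * d * ε ^ n := by
    rw [hQ]
    nlinarith
  have hge : ε ^ n - 2 ≤ Q := by
    rw [hQ]
    nlinarith
  have hQpos : 0 < Q := by linarith
  refine ⟨hge, hle, ?_⟩
  rw [le_div_iff₀ (by positivity)]
  apply Real.le_sqrt_of_sq_le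
  rw [mul_pow, Real.sq_sqrt (by linarith)]
  have h1 : ε ^ n * (‖ω‖ ^ n) ^ 2 = 1 := by
    rw [← pow_mul, mul_comm n 2, pow_mul, ← mul_pow, hεω, one_pow]
  calc (‖ω‖ ^ n) ^ 2 * Q ≤ (‖ω‖ ^ n) ^ 2 * (3 * d * ε ^ n) := by gcongr
    _ = 3 * d := by linear_combination 3 * d * h1

/-- **Theorem 3.** If `K ⊆ ℝ` is a cubic field with exactly one real embedding and
`α, β ∈ K`, then there is a Peck sequence for the pair `(α, β)`. -/
theorem peck_sequence_for_pair_in_cubic_field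
    (K : IntermediateField ℚ ℝ)
    (hdeg : Module.finrank ℚ K = 3)
    (hemb : ∀ f g : K →+* ℝ, f = g)
    (α β : ℝ) (hα : α ∈ K) (hβ : β ∈ K) :
    ∃ (s : ℕ → ℕ) (M₁ M₂ : ℝ) (j : ℕ → ℕ),
      StrictMono s ∧ (∀ n, 0 < s n) ∧ 0 < M₁ ∧ 0 < M₂ ∧ StrictMono j ∧
      (∀ n, 2 ≤ s (j n)) ∧
      (∀ n, max (distNearestInt ((s n : ℝ) * α)) (distNearestInt ((s n : ℝ) * β))
          < M₁ / Real.sqrt (s n)) ∧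
      (∀ n, distNearestInt ((s (j n) : ℝ) * α)
          < M₂ / (Real.sqrt (s (j n)) * Real.log (s (j n)))) := by
  have : FiniteDimensional ℚ K := Module.finite_of_finrank_pos (by omega)
  have : NumberField K := ⟨⟩
  let ι : K →+* ℝ := algebraMap K ℝ
  obtain ⟨σ, u, hu, hε, hεω, him, hintegral⟩ :=
    exists_expanding_unit_of_cubic hdeg (ι := ι) (fun f ↦ hemb f ι)
  let a : K := ⟨α, hα⟩
  let b : K := ⟨β, hβ⟩
  obtain ⟨d, hd, hda, hdb⟩ := exists_pos_isIntegral_mul a b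
  have hd1 : (1 : ℝ) ≤ d := by exact_mod_cast hd
  have hQ (n : ℕ) : ∃ Q : ℤ, (Q : ℝ) = d * (ι u ^ n + 2 * (σ u ^ n).re) := by
    obtain ⟨Q, hQ⟩ := hintegral ((d : K) * u ^ n)
      ((isIntegral_algebraMap (R := ℤ) (x := d)).mul (hu.pow n))
    refine ⟨Q, ?_⟩
    rw [hQ, map_mul, map_mul, map_pow, map_pow, map_intCast, map_intCast,
      ← Complex.ofReal_intCast, Complex.re_ofReal_mul]
    ring
  choose Q hQ using hQ
  have hdist (x : K) (hx : IsIntegral ℤ ((d : K) * x)) (n : ℕ) :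
      distNearestInt (Q n * ι x) ≤ 2 * d * |(((ι x : ℂ) - σ x) * σ u ^ n).re| := by
    obtain ⟨P, hP⟩ := hintegral ((d : K) * x * u ^ n) (hx.mul (hu.pow n))
    refine (distNearestInt_le _ P).trans (le_of_eq ?_)
    rw [← abs_of_pos (by linarith : (0 : ℝ) < 2 * d), ← abs_mul, hP, hQ]
    congr 1
    rw [map_mul, map_mul, map_mul, map_mul, map_pow, map_pow, map_intCast, map_intCast,
      mul_assoc (d : ℂ),
      ← Complex.ofReal_intCast, Complex.re_ofReal_mul, sub_mul, Complex.sub_re,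
      Complex.re_ofReal_mul]
    ring
  set ω := σ u
  set ε := ι u
  set A := √(3 * (d : ℝ))
  set L := Real.log (3 * d) + Real.log ε
  have hL : 0 < L := add_pos (Real.log_pos (by linarith)) (Real.log_pos hε)
  set za := ‖(ι a : ℂ) - σ a‖
  set zb := ‖(ι b : ℂ) - σ b‖
  set M₁ := 2 * d * (za + zb) * A + 1
  set M₂ := 2 * d * (za * A * (5 * Real.pi * L)) + 1
  have hpi := Real.pi_pos
  have hfreq : ∃ᶠ s : ℕ in Filter.atTop, 2 ≤ s ∧
      max (distNearestInt ((s : ℝ) * α)) (distNearestInt ((s : ℝ) * β)) < M₁ / √s ∧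
      distNearestInt ((s : ℝ) * α) < M₂ / (√s * Real.log s) := by
    rw [Filter.frequently_atTop]
    intro N
    obtain ⟨n₀, hn₀⟩ := Filter.eventually_atTop.1
      ((tendsto_pow_atTop_atTop_of_one_lt hε).eventually_ge_atTop ((N : ℝ) + 4))
    obtain ⟨n, hn, hnpos, hre⟩ := exists_abs_re_mul_pow_le him ((ι a : ℂ) - σ a) n₀
    have hεn := hn₀ n hn
    obtain ⟨hge, hle, hpow⟩ := norm_pow_le_div_sqrt hε hεω hd1 n (hQ n)
      (by linarith [N.cast_nonneg (α := ℝ)])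
    have hgeN : (N : ℝ) + 2 ≤ Q n := by linarith
    have hgeZ : (N : ℤ) + 2 ≤ Q n := by exact_mod_cast hgeN
    have hcast : (((Q n).toNat : ℕ) : ℝ) = Q n := by
      rw [← Int.cast_natCast, Int.toNat_of_nonneg (by omega)]
    have hQ2 : (2 : ℝ) ≤ Q n := by linarith [N.cast_nonneg (α := ℝ)]
    refine ⟨(Q n).toNat, by omega, by omega, ?_⟩
    rw [hcast]
    have hsqrt : 0 < √(Q n : ℝ) := Real.sqrt_pos.2 (by linarith)
    have hlog : 0 < Real.log (Q n) := Real.log_pos (by linarith)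
    have hn1 : (1 : ℝ) ≤ n := by exact_mod_cast hnpos
    have hbound (x : K) (hx : IsIntegral ℤ ((d : K) * x)) (z : ℝ) (hz : 0 ≤ z)
        (hxz : ‖(ι x : ℂ) - σ x‖ + z = za + zb) : distNearestInt (Q n * ι x) < M₁ / √(Q n) := by
      calc distNearestInt (Q n * ι x)
          ≤ 2 * d * |(((ι x : ℂ) - σ x) * ω ^ n).re| := hdist x hx n
        _ ≤ 2 * d * ‖((ι x : ℂ) - σ x) * ω ^ n‖ := by gcongr; exact Complex.abs_re_le_norm _
        _ ≤ 2 * d * ((za + zb) * (A / √(Q n))) := by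
            rw [norm_mul, norm_pow]
            gcongr
            linarith
        _ = (2 * d * (za + zb) * A) / √(Q n) := by ring
        _ < M₁ / √(Q n) := by gcongr; linarith
    refine ⟨max_lt (hbound a hda zb (norm_nonneg _) rfl)
      (hbound b hdb za (norm_nonneg _) (add_comm _ _)), ?_⟩
    have hlogle : Real.log (Q n) ≤ n * L := by
      calc Real.log (Q n) ≤ Real.log (3 * d * ε ^ n) := Real.log_le_log (by linarith) hle
        _ = Real.log (3 * d) + n * Real.log ε := by
            rw [Real.log_mul (by positivity) (by positivity), Real.log_pow]
        _ ≤ n * L := by nlinarith [Real.log_pos (by linarith : (1 : ℝ) < 3 * d)]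
    have hinv : 5 * Real.pi / n ≤ 5 * Real.pi * L / Real.log (Q n) := by
      rw [div_le_div_iff₀ (by positivity) hlog]
      nlinarith
    calc distNearestInt (Q n * ι a)
        ≤ 2 * d * |(((ι a : ℂ) - σ a) * ω ^ n).re| := hdist a hda n
      _ ≤ 2 * d * (za * ‖ω‖ ^ n * (5 * Real.pi / n)) := by gcongr
      _ ≤ 2 * d * (za * (A / √(Q n)) * (5 * Real.pi * L / Real.log (Q n))) := by gcongr
      _ = (2 * d * (za * A * (5 * Real.pi * L))) / (√(Q n) * Real.log (Q n)) := by
          field_simp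
      _ < M₂ / (√(Q n) * Real.log (Q n)) := by gcongr; linarith
  obtain ⟨s, hs, h⟩ := Filter.extraction_of_frequently_atTop hfreq
  exact ⟨s, M₁, M₂, id, hs, fun n ↦ by linarith [(h n).1], by positivity, by positivity,
    strictMono_id, fun n ↦ (h n).1, fun n ↦ (h n).2.1, fun n ↦ (h n).2.2⟩
end

section
/- With the setup below, let n be a positive integer. (a) If λ^(n/2) > 2√2·d·C₁/|θ|, then ⟨kₙ·θ⟩ = −d·(bₙ·θ − cₙ·θ²)/θ, i.e., the signed distance from kₙ·θ to the nearest integer equals −d·(bₙ − cₙ·θ). (b) If λ^(n/2) > 2·d·C₁, then ⟨kₙ·θ²⟩ = −d·(aₙ + p·cₙ − cₙ·θ²). -/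
open Polynomial

/-- `⟨x⟩ = x - ⌊x + 1/2⌋`, the signed distance from `x` to the nearest integer. -/
noncomputable def signedDistNearestInt (x : ℝ) : ℝ := x - round x

/-- An integer whose distance from `x` is less than `1/2` is the nearest integer to `x`. -/
lemma signedDistNearestInt_eq_of_abs_lt {x y : ℝ} (m : ℤ) (hxy : x = m + y)
    (hy : 2 * |y| < 1) : signedDistNearestInt x = y := by
  obtain ⟨h₁, h₂⟩ := abs_lt.mp (show |y| < 1 / 2 by linarith)
  have hm : round x = m := by
    rw [round_eq_iff, hxy]
    constructor <;> linarith
  rw [signedDistNearestInt, hm, hxy]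
  ring

/-- A positive rational number that is integral over `ℤ` together with its inverse equals `1`. -/
lemma ratCast_eq_one_of_isIntegral_of_isIntegral_inv {r : ℚ} (hr : 0 < r)
    (h : IsIntegral ℤ (r : ℝ)) (hinv : IsIntegral ℤ (r : ℝ)⁻¹) : r = 1 := by
  have hQ : IsIntegral ℤ r :=
    (isIntegral_algebraMap_iff (B := ℝ) (algebraMap ℚ ℝ).injective).mp (by simpa using h)
  have hQinv : IsIntegral ℤ r⁻¹ :=
    (isIntegral_algebraMap_iff (B := ℝ) (algebraMap ℚ ℝ).injective).mp (by simpa using hinv)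
  obtain ⟨m, hm⟩ := IsIntegrallyClosed.isIntegral_iff.mp hQ
  obtain ⟨l, hl⟩ := IsIntegrallyClosed.isIntegral_iff.mp hQinv
  simp only [eq_intCast] at hm hl
  have hm0 : 0 < m := by exact_mod_cast hm ▸ hr
  have hl0 : 0 < l := by exact_mod_cast hl ▸ inv_pos.mpr hr
  have hml : m * l = 1 := by
    have : (m : ℚ) * l = 1 := by rw [hm, hl, mul_inv_cancel₀ hr.ne']
    exact_mod_cast this
  have : m = 1 := by nlinarith
  rw [← hm, this, Int.cast_one]

section Cubic

variable {p q : ℤ}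

lemma monic_depressedCubic (p q : ℚ) : (X ^ 3 - C p * X - C q : ℚ[X]).Monic := by
  monicity!

lemma natDegree_depressedCubic (p q : ℚ) : (X ^ 3 - C p * X - C q : ℚ[X]).natDegree = 3 := by
  compute_degree!

/-- The powers `1, θ, θ²` of a root of an irreducible rational cubic are independent over `ℚ`. -/
lemma coeffs_eq_zero_of_irreducible_cubic {θ : ℝ}
    (hirr : Irreducible (X ^ 3 - C (p : ℚ) * X - C (q : ℚ)))
    (hroot : θ ^ 3 - (p : ℝ) * θ - (q : ℝ) = 0) {u v w : ℚ}
    (h : (u : ℝ) + v * θ + w * θ ^ 2 = 0) : u = 0 ∧ v = 0 ∧ w = 0 := by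
  have hmin := minpoly.eq_of_irreducible_of_monic (x := θ) hirr (by simpa using hroot)
    (monic_depressedCubic _ _)
  have hdvd : minpoly ℚ θ ∣ C w * X ^ 2 + C v * X + C u :=
    minpoly.dvd ℚ θ (by simp; linarith)
  rw [← hmin] at hdvd
  have hzero : (C w * X ^ 2 + C v * X + C u : ℚ[X]) = 0 :=
    eq_zero_of_dvd_of_natDegree_lt hdvd
      ((natDegree_quadratic_le).trans_lt (by rw [natDegree_depressedCubic]; norm_num))
  refine ⟨?_, ?_, ?_⟩
  · simpa [coeff_X] using congrArg (coeff · 0) hzero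
  · simpa [coeff_X, coeff_C] using congrArg (coeff · 1) hzero
  · simpa [coeff_X, coeff_C] using congrArg (coeff · 2) hzero

/-- If `θ` is the only real root of `x³ - p x - q` and `θ ≠ 0`, the quadratic cofactor of `x - θ`
has negative discriminant. -/
lemma cofactor_discrim_pos {p q θ : ℝ} (hθ : θ ≠ 0)
    (hroot : θ ^ 3 - p * θ - q = 0)
    (huniq : ∀ x : ℝ, x ^ 3 - p * x - q = 0 → x = θ) : 0 < 3 * θ ^ 2 - 4 * p := by
  by_contra! hneg
  obtain ⟨r, hr⟩ : ∃ r : ℝ, r ^ 2 = 4 * p - 3 * θ ^ 2 :=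
    ⟨_, Real.sq_sqrt (by linarith)⟩
  have h₁ := huniq ((-θ + r) / 2) (by linear_combination hroot + (r - 3 * θ) / 8 * hr)
  have h₂ := huniq ((-θ - r) / 2) (by linear_combination hroot + (-r - 3 * θ) / 8 * hr)
  exact hθ (by linarith)

/-- Integrality passes to conjugates: an integral element `u + vθ + wθ²` of `ℚ(θ)` stays integral
when the real root `θ` is replaced by a complex root `z` of the same irreducible cubic, and so does
its inverse. -/
lemma isIntegral_conjugate {θ : ℝ} {z : ℂ}
    (hirr : Irreducible (X ^ 3 - C (p : ℚ) * X - C (q : ℚ)))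
    (hroot : θ ^ 3 - (p : ℝ) * θ - (q : ℝ) = 0) (hz : z ^ 3 - (p : ℂ) * z - (q : ℂ) = 0)
    {x : ℝ} {u v w : ℚ} (hx : x = u + v * θ + w * θ ^ 2)
    (hint : IsIntegral ℤ x) (hintinv : IsIntegral ℤ x⁻¹) :
    IsIntegral ℤ (u + v * z + w * z ^ 2) ∧ IsIntegral ℤ (u + v * z + w * z ^ 2)⁻¹ := by
  have : Fact (Irreducible (X ^ 3 - C (p : ℚ) * X - C (q : ℚ))) := ⟨hirr⟩
  let K := AdjoinRoot (X ^ 3 - C (p : ℚ) * X - C (q : ℚ))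
  let σ : K →ₐ[ℚ] ℝ := AdjoinRoot.liftAlgHom _ (Algebra.ofId ℚ ℝ) θ
    (by simpa [-map_intCast, eval₂_C] using hroot)
  let τ : K →ₐ[ℚ] ℂ := AdjoinRoot.liftAlgHom _ (Algebra.ofId ℚ ℂ) z
    (by simpa [-map_intCast, eval₂_C] using hz)
  let ρ : K := AdjoinRoot.root _
  have hσρ : σ ρ = θ := AdjoinRoot.liftAlgHom_root _ _ _ _
  have hτρ : τ ρ = z := AdjoinRoot.liftAlgHom_root _ _ _ _
  let α : K := algebraMap ℚ K u + algebraMap ℚ K v * ρ + algebraMap ℚ K w * ρ ^ 2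
  have hσ : σ α = x := by
    simp only [α, map_add, map_mul, map_pow, hσρ, hx, eq_ratCast, map_ratCast]
  have hτ : τ α = u + v * z + w * z ^ 2 := by
    simp only [α, map_add, map_mul, map_pow, hτρ, eq_ratCast, map_ratCast]
  have transfer : ∀ β : K, IsIntegral ℤ (σ β) → IsIntegral ℤ (τ β) := fun β hβ ↦
    ((isIntegral_algHom_iff (σ.restrictScalars ℤ) σ.injective).mp hβ).map (τ.restrictScalars ℤ)
  rw [← hτ, ← map_inv₀]
  exact ⟨transfer α (hσ ▸ hint), transfer α⁻¹ (by rwa [map_inv₀, hσ])⟩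

/-- The norm form of a positive unit `x = u + vθ + wθ²` of a complex cubic field, written through
the real and imaginary parts of its complex conjugate, equals `1`. -/
lemma norm_unit_eq_one {θ : ℝ}
    (hirr : Irreducible (X ^ 3 - C (p : ℚ) * X - C (q : ℚ)))
    (hroot : θ ^ 3 - (p : ℝ) * θ - (q : ℝ) = 0) (hD : 0 < 3 * θ ^ 2 - 4 * (p : ℝ))
    {x : ℝ} (hx0 : 0 < x) {u v w : ℚ} (hx : x = u + v * θ + w * θ ^ 2)
    (hint : IsIntegral ℤ x) (hintinv : IsIntegral ℤ x⁻¹) :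
    x * ((u + p * w - w * θ ^ 2 - θ / 2 * (v - w * θ)) ^ 2
      + (3 * θ ^ 2 - 4 * p) / 4 * (v - w * θ) ^ 2) = 1 := by
  obtain ⟨s, hs⟩ : ∃ s : ℝ, s ^ 2 = (3 * θ ^ 2 - 4 * p) / 4 :=
    ⟨_, Real.sq_sqrt (by linarith)⟩
  let z : ℂ := ⟨-θ / 2, s⟩
  have hz : z ^ 3 - (p : ℂ) * z - (q : ℂ) = 0 := by
    apply Complex.ext
    · simp [z, pow_succ]
      linear_combination hroot + 3 * θ / 2 * hs
    · simp [z, pow_succ]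
      linear_combination (-s) * hs
  obtain ⟨hμ, hμinv⟩ := isIntegral_conjugate hirr hroot hz hx hint hintinv
  set μ : ℂ := u + v * z + w * z ^ 2 with hμdef
  have hnorm : Complex.normSq μ = (u + p * w - w * θ ^ 2 - θ / 2 * (v - w * θ)) ^ 2
      + (3 * θ ^ 2 - 4 * p) / 4 * (v - w * θ) ^ 2 := by
    have hre : μ.re = u + p * w - w * θ ^ 2 - θ / 2 * (v - w * θ) := by
      simp [hμdef, z, pow_succ]
      linear_combination (-w : ℝ) * hs
    have him : μ.im = s * (v - w * θ) := by
      simp [hμdef, z, pow_succ]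
      ring
    rw [Complex.normSq_apply, hre, him]
    linear_combination (v - w * θ : ℝ) ^ 2 * hs
  have isIntegral_normSq : ∀ y : ℂ, IsIntegral ℤ y → IsIntegral ℤ (Complex.normSq y) := by
    intro y hy
    refine (isIntegral_algebraMap_iff (B := ℂ) (algebraMap ℝ ℂ).injective).mp ?_
    rw [Complex.coe_algebraMap, Complex.normSq_eq_conj_mul_self]
    exact (hy.map (starRingEnd ℂ).toIntAlgHom).mul hy
  let N : ℚ := w ^ 3 * q ^ 2 + (v ^ 3 - 3 * u * v * w - p * v * w ^ 2) * q
    + u ^ 3 + 2 * u ^ 2 * p * w + u * p ^ 2 * w ^ 2 - u * p * v ^ 2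
  have hN : x * Complex.normSq μ = N := by
    rw [hnorm, hx]
    push_cast [N]
    linear_combination
      ((w : ℝ) ^ 3 * (θ ^ 3 - p * θ + q) + (v ^ 3 - 3 * u * v * w - p * v * w ^ 2)) * hroot
  have hNint : IsIntegral ℤ (N : ℝ) := hN ▸ hint.mul (isIntegral_normSq _ hμ)
  have hNinv : IsIntegral ℤ (N : ℝ)⁻¹ := by
    rw [← hN, mul_inv, ← map_inv₀]
    exact hintinv.mul (isIntegral_normSq _ hμinv)
  have hμ0 : μ ≠ 0 := by
    intro h0
    have hzero : (v : ℝ) - w * θ = 0 ∧ (u : ℝ) + p * w - w * θ ^ 2 = 0 := by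
      rw [h0, map_zero] at hnorm
      have h₁ : (v : ℝ) - w * θ = 0 := by
        by_contra hne
        have := mul_pos hD (sq_pos_of_ne_zero hne)
        nlinarith [sq_nonneg (u + p * w - w * θ ^ 2 - θ / 2 * (v - w * θ))]
      refine ⟨h₁, ?_⟩
      rw [h₁] at hnorm
      simpa using hnorm.symm
    have hv := coeffs_eq_zero_of_irreducible_cubic hirr hroot (u := v) (v := -w) (w := 0)
      (by push_cast; linarith [hzero.1])
    have hw : w = 0 := neg_eq_zero.mp hv.2.1
    have hu : (u : ℝ) = 0 := by simpa [hw] using hzero.2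
    rw [hx, hu, hv.1, hw] at hx0
    simp at hx0
  have hN0 : 0 < N := by
    have : 0 < (N : ℝ) := hN ▸ mul_pos hx0 (Complex.normSq_pos.mpr hμ0)
    exact_mod_cast this
  rw [← hnorm, hN, ratCast_eq_one_of_isIntegral_of_isIntegral_inv hN0 hNint hNinv, Rat.cast_one]

end Cubic

/-- **Lemma.** With the usual setup (`θ` the unique real root of the irreducible
`x³ - p x - q ∈ ℤ[x]`, `d` a positive integer with `O_K ⊆ (1/d)ℤ[θ]`, `λ > 1` a unit of `O_K`,
`λⁿ = aₙ + bₙθ + cₙθ²`, `kₙ = d cₙ`, `C₁ = max{√2, √2|θ|/√(3θ²-4p)}`):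
(a) if `λ^(n/2) > 2√2 d C₁/|θ|` then `⟨kₙθ⟩ = -d(bₙθ - cₙθ²)/θ`, i.e. `= -d(bₙ - cₙθ)`;
(b) if `λ^(n/2) > 2 d C₁` then `⟨kₙθ²⟩ = -d(aₙ + p cₙ - cₙθ²)`. -/
theorem signed_dist_of_kn_theta
    (p q : ℤ) (θ : ℝ)
    (hirr : Irreducible (X ^ 3 - C (p : ℚ) * X - C (q : ℚ)))
    (hroot : θ ^ 3 - (p : ℝ) * θ - (q : ℝ) = 0)
    (huniq : ∀ x : ℝ, x ^ 3 - (p : ℝ) * x - (q : ℝ) = 0 → x = θ)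
    (d : ℕ) (hd0 : 0 < d)
    (hd : ∀ x : ℝ, IsIntegral ℤ x → (∃ u v w : ℚ, x = (u : ℝ) + (v : ℝ) * θ + (w : ℝ) * θ ^ 2) →
      ∃ e f g : ℤ, (d : ℝ) * x = (e : ℝ) + (f : ℝ) * θ + (g : ℝ) * θ ^ 2)
    (lam : ℝ) (hlam : 1 < lam)
    (hint : IsIntegral ℤ lam) (hintinv : IsIntegral ℤ lam⁻¹)
    (a b c : ℕ → ℚ)
    (hcoord : ∀ n : ℕ, 1 ≤ n →
      lam ^ n = (a n : ℝ) + (b n : ℝ) * θ + (c n : ℝ) * θ ^ 2)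
    (C₁ : ℝ)
    (hC₁ : C₁ = max (Real.sqrt 2) (Real.sqrt 2 * |θ| / Real.sqrt (3 * θ ^ 2 - 4 * (p : ℝ))))
    (k : ℕ → ℝ) (hk : ∀ n, k n = (d : ℝ) * (c n : ℝ))
    (n : ℕ) (hn : 1 ≤ n) :
    (lam ^ ((n : ℝ) / 2) > 2 * Real.sqrt 2 * (d : ℝ) * C₁ / |θ| →
      signedDistNearestInt (k n * θ)
        = -(d : ℝ) * ((b n : ℝ) * θ - (c n : ℝ) * θ ^ 2) / θ ∧
      signedDistNearestInt (k n * θ) = -(d : ℝ) * ((b n : ℝ) - (c n : ℝ) * θ)) ∧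
    (lam ^ ((n : ℝ) / 2) > 2 * (d : ℝ) * C₁ →
      signedDistNearestInt (k n * θ ^ 2)
        = -(d : ℝ) * ((a n : ℝ) + (p : ℝ) * (c n : ℝ) - (c n : ℝ) * θ ^ 2)) := by
  have hθ : θ ≠ 0 := by
    rintro rfl
    simpa using coeffs_eq_zero_of_irreducible_cubic hirr hroot (u := 0) (v := 1) (w := 0) (by simp)
  have hD := cofactor_discrim_pos hθ hroot huniq
  have hlam0 : 0 < lam := by linarith
  have hx := hcoord n hn
  have hnorm := norm_unit_eq_one hirr hroot hD (pow_pos hlam0 n) hx (hint.pow n)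
    (by rw [← inv_pow]; exact hintinv.pow n)
  obtain ⟨e, f, g, hefg⟩ := hd _ (hint.pow n) ⟨_, _, _, hx⟩
  obtain ⟨he, hf, hg⟩ := coeffs_eq_zero_of_irreducible_cubic hirr hroot
    (u := d * a n - e) (v := d * b n - f) (w := d * c n - g)
    (by push_cast; linear_combination hefg - (d : ℝ) * hx)
  have heR : (d : ℝ) * a n - e = 0 := by exact_mod_cast congrArg (Rat.cast (K := ℝ)) he
  have hfR : (d : ℝ) * b n - f = 0 := by exact_mod_cast congrArg (Rat.cast (K := ℝ)) hf
  have hgR : (d : ℝ) * c n - g = 0 := by exact_mod_cast congrArg (Rat.cast (K := ℝ)) hg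
  have hLsq : lam ^ n = (lam ^ ((n : ℝ) / 2)) ^ 2 := by
    rw [← Real.rpow_natCast (lam ^ ((n : ℝ) / 2)), ← Real.rpow_mul hlam0.le]
    simp
  rw [hLsq] at hnorm
  have hL : 0 < lam ^ ((n : ℝ) / 2) := Real.rpow_pos_of_pos hlam0 _
  generalize lam ^ ((n : ℝ) / 2) = L at hnorm hL ⊢
  set D := 3 * θ ^ 2 - 4 * (p : ℝ)
  have hd' : (0 : ℝ) < d := by exact_mod_cast hd0
  have hC0 : 0 ≤ C₁ := hC₁ ▸ (Real.sqrt_nonneg 2).trans (le_max_left _ _)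
  have hC2 : 2 ≤ C₁ ^ 2 := by
    have : √2 ≤ C₁ := hC₁ ▸ le_max_left _ _
    nlinarith [Real.sq_sqrt (show (0 : ℝ) ≤ 2 by norm_num), Real.sqrt_nonneg 2]
  have hCD : 2 * θ ^ 2 ≤ C₁ ^ 2 * D := by
    have h : √2 * |θ| / √D ≤ C₁ := hC₁ ▸ le_max_right _ _
    rw [div_le_iff₀ (Real.sqrt_pos.mpr hD)] at h
    have := pow_le_pow_left₀ (by positivity) h 2
    rwa [mul_pow, mul_pow, sq_abs, Real.sq_sqrt hD.le, Real.sq_sqrt (by norm_num)] at this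
  have hxy : L ^ 2 * (b n - c n * θ) ^ 2 * D ≤ 4 := by
    linarith [sq_nonneg (L * (a n + p * c n - c n * θ ^ 2 - θ / 2 * (b n - c n * θ)))]
  have bound_b : L * |b n - c n * θ| * |θ| ≤ √2 * C₁ := by
    refine (sq_le_sq₀ (by positivity) (by positivity)).mp ?_
    rw [mul_pow, mul_pow, mul_pow, sq_abs, sq_abs, Real.sq_sqrt (by norm_num)]
    linarith [mul_le_mul_of_nonneg_left hCD (sq_nonneg (L * (b n - c n * θ))),
      mul_le_mul_of_nonneg_left hxy (sq_nonneg C₁)]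
  have bound_a : L * |a n + p * c n - c n * θ ^ 2| ≤ C₁ := by
    refine (sq_le_sq₀ (by positivity) hC0).mp ?_
    rw [mul_pow, sq_abs]
    set x : ℝ := b n - c n * θ
    set y : ℝ := a n + p * c n - c n * θ ^ 2
    have hcauchy : y ^ 2 * D ≤ ((y - θ / 2 * x) ^ 2 + D / 4 * x ^ 2) * (D + θ ^ 2) := by
      linear_combination sq_nonneg (θ * (y - θ / 2 * x) - D / 2 * x)
    refine le_of_mul_le_mul_right ?_ hD
    calc L ^ 2 * y ^ 2 * D = L ^ 2 * (y ^ 2 * D) := by ring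
      _ ≤ L ^ 2 * (((y - θ / 2 * x) ^ 2 + D / 4 * x ^ 2) * (D + θ ^ 2)) := by gcongr
      _ = D + θ ^ 2 := by rw [← mul_assoc, hnorm, one_mul]
      _ ≤ C₁ ^ 2 * D := by linarith [mul_le_mul_of_nonneg_right hC2 hD.le]
  constructor
  · intro hbig
    have hmain : signedDistNearestInt (k n * θ) = -(d : ℝ) * ((b n : ℝ) - (c n : ℝ) * θ) := by
      apply signedDistNearestInt_eq_of_abs_lt f
      · rw [hk]
        linear_combination hfR
      · have hθ' := abs_pos.mpr hθ
        rw [gt_iff_lt, div_lt_iff₀ hθ'] at hbig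
        rw [abs_mul, abs_neg, Nat.abs_cast]
        refine lt_of_mul_lt_mul_right ?_ (mul_pos hL hθ').le
        linarith [mul_le_mul_of_nonneg_left bound_b hd'.le]
    refine ⟨?_, hmain⟩
    rw [hmain]
    field_simp
  · intro hbig
    apply signedDistNearestInt_eq_of_abs_lt (e + p * g)
    · rw [hk]
      push_cast
      linear_combination heR + p * hgR
    · rw [abs_mul, abs_neg, Nat.abs_cast]
      refine lt_of_mul_lt_mul_right ?_ hL.le
      linarith [mul_le_mul_of_nonneg_left bound_a hd'.le]
end

section
/- With the setup below, let n be a positive integer. (a) If λ^(3n/2) > (1 + √2)·C₁, then cₙ > 0. (b) If λ^(3n/2) > (1 + √2)·C₁/(√λ·(√λ − 1)), then cₙ₊₁ > cₙ. -/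
open Polynomial

/-- The quadratic cofactor of a cubic with a single real root has negative discriminant. -/
lemma discr_pos_of_unique_real_root {p q : ℤ} {θ : ℝ}
    (hirr : Irreducible (X ^ 3 - C (p : ℚ) * X - C (q : ℚ)))
    (hroot : θ ^ 3 - (p : ℝ) * θ - (q : ℝ) = 0)
    (huniq : ∀ x : ℝ, x ^ 3 - (p : ℝ) * x - (q : ℝ) = 0 → x = θ) :
    0 < 3 * θ ^ 2 - 4 * (p : ℝ) := by
  by_contra! h
  have hs : √(4 * (p : ℝ) - 3 * θ ^ 2) ^ 2 = 4 * p - 3 * θ ^ 2 := Real.sq_sqrt (by linarith)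
  set s := √(4 * (p : ℝ) - 3 * θ ^ 2)
  have h₁ := huniq ((-θ + s) / 2) (by
    linear_combination (-θ * 3 / 8 + s / 8) * hs + hroot)
  have h₂ := huniq ((-θ - s) / 2) (by
    linear_combination (-θ * 3 / 8 - s / 8) * hs + hroot)
  have hθ : θ = 0 := by linarith
  have hs0 : s = 0 := by linarith
  have hp : (p : ℝ) = 0 := by rw [hs0, hθ] at hs; linarith
  have hq : (q : ℝ) = 0 := by rw [hθ] at hroot; linarith
  norm_cast at hp hq
  subst hp hq
  have hX : Irreducible ((X : ℚ[X]) ^ 3) := by simpa using hirr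
  exact not_irreducible_pow (by norm_num) hX

/-- The minimal polynomial of a real root of an irreducible depressed cubic. -/
lemma minpoly_eq_depressed_cubic {p q : ℤ} {θ : ℝ}
    (hirr : Irreducible (X ^ 3 - C (p : ℚ) * X - C (q : ℚ)))
    (hroot : θ ^ 3 - (p : ℝ) * θ - (q : ℝ) = 0) :
    X ^ 3 - C (p : ℚ) * X - C (q : ℚ) = minpoly ℚ θ :=
  minpoly.eq_of_irreducible_of_monic hirr (by simpa using hroot) (by monicity!)

/-- A conjugate root in `ℂ` induces an embedding of the field generated by a root. -/
lemma exists_ringHom_adjoin_root {p q : ℤ} {θ : ℝ} {τ : ℂ}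
    (hirr : Irreducible (X ^ 3 - C (p : ℚ) * X - C (q : ℚ)))
    (hroot : θ ^ 3 - (p : ℝ) * θ - (q : ℝ) = 0)
    (hτ : τ ^ 3 - (p : ℂ) * τ - (q : ℂ) = 0) :
    ∃ σ : IntermediateField.adjoin ℚ {θ} →+* ℂ,
      σ (IntermediateField.AdjoinSimple.gen ℚ θ) = τ := by
  have hmin := minpoly_eq_depressed_cubic hirr hroot
  have hint : IsIntegral ℚ θ := by
    refine ⟨X ^ 3 - C (p : ℚ) * X - C (q : ℚ), by monicity!, ?_⟩
    rw [← aeval_def]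
    simpa using hroot
  refine ⟨((IntermediateField.adjoin.powerBasis hint).lift τ ?_).toRingHom, ?_⟩
  · rw [IntermediateField.adjoin.powerBasis_gen, IntermediateField.minpoly_gen, ← hmin]
    simpa using hτ
  · exact PowerBasis.lift_gen (IntermediateField.adjoin.powerBasis hint) τ _

/-- A positive rational number that is integral together with its inverse equals `1`. -/
lemma rat_eq_one_of_isIntegral_of_isIntegral_inv {r : ℚ} (hr : 0 < r)
    (h : IsIntegral ℤ r) (h' : IsIntegral ℤ r⁻¹) : r = 1 := by
  obtain ⟨m, hm⟩ := IsIntegrallyClosed.isIntegral_iff.mp h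
  obtain ⟨k, hk⟩ := IsIntegrallyClosed.isIntegral_iff.mp h'
  simp only [algebraMap_int_eq, eq_intCast] at hm hk
  have hmk : m * k = 1 := by
    have : (m : ℚ) * k = 1 := by rw [hm, hk, mul_inv_cancel₀ hr.ne']
    exact_mod_cast this
  have hm0 : 0 < m := by rw [← hm] at hr; exact_mod_cast hr
  have : m = 1 := by
    rcases Int.mul_eq_one_iff_eq_one_or_neg_one.mp hmk with h | h <;> omega
  rw [← hm, this, Int.cast_one]

/-- The non-real root `-θ/2 + (√(3θ² - 4p)/2) i` of the cubic, given `s² = 3θ² - 4p`. -/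
lemma conj_root_of_sq_eq {p q : ℤ} {θ s : ℝ}
    (hroot : θ ^ 3 - (p : ℝ) * θ - (q : ℝ) = 0) (hs : s ^ 2 = 3 * θ ^ 2 - 4 * (p : ℝ)) :
    (⟨-θ / 2, s / 2⟩ : ℂ) ^ 3 - (p : ℂ) * ⟨-θ / 2, s / 2⟩ - (q : ℂ) = 0 := by
  apply Complex.ext
  · simp [pow_succ]
    linear_combination (3 * θ / 8) * hs + hroot
  · simp [pow_succ]
    linear_combination (- s / 8) * hs

/-- The norm form of `x + yθ + zθ²`. -/
lemma mul_normSq_conj_eq {p q : ℤ} {θ s : ℝ} (x y z : ℝ)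
    (hroot : θ ^ 3 - (p : ℝ) * θ - (q : ℝ) = 0) (hs : s ^ 2 = 3 * θ ^ 2 - 4 * (p : ℝ)) :
    (x + y * θ + z * θ ^ 2) *
        Complex.normSq (x + y * (⟨-θ / 2, s / 2⟩ : ℂ) + z * (⟨-θ / 2, s / 2⟩ : ℂ) ^ 2) =
      x ^ 3 + y ^ 3 * q + z ^ 3 * q ^ 2 + 2 * p * x ^ 2 * z - p * x * y ^ 2 + p ^ 2 * x * z ^ 2
        - p * q * y * z ^ 2 - 3 * q * x * y * z := by
  have hq : (q : ℝ) = θ ^ 3 - p * θ := by linarith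
  have hp : (p : ℝ) = (3 * θ ^ 2 - s ^ 2) / 4 := by linarith
  rw [hq, hp]
  simp [Complex.normSq_apply, pow_succ]
  ring

/-- Lagrange interpolation for the leading coefficient of `x + yθ + zθ²`. -/
lemma mul_deriv_eq_sub_re {p : ℤ} {θ s : ℝ} (x y z : ℝ)
    (hs0 : 0 < s) (hs : s ^ 2 = 3 * θ ^ 2 - 4 * (p : ℝ)) :
    z * (3 * θ ^ 2 - p) = (x + y * θ + z * θ ^ 2) -
      ((x + y * (⟨-θ / 2, s / 2⟩ : ℂ) + z * (⟨-θ / 2, s / 2⟩ : ℂ) ^ 2) *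
        (⟨1, -(3 * θ / s)⟩ : ℂ)).re := by
  have hp : (p : ℝ) = (3 * θ ^ 2 - s ^ 2) / 4 := by linarith
  rw [hp]
  simp [pow_succ]
  field_simp
  ring

lemma norm_interpolation_weight_le {θ s : ℝ} (hs0 : 0 < s) :
    ‖(⟨1, -(3 * θ / s)⟩ : ℂ)‖ ≤ (1 + √2) * max √2 (√2 * |θ| / s) := by
  have h2 : √2 ^ 2 = 2 := Real.sq_sqrt (by norm_num)
  have h1 : 1 < √2 := by nlinarith [Real.sqrt_nonneg 2]
  set t := |θ| / s with ht
  have ht0 : 0 ≤ t := by positivity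
  have hts : (θ / s) ^ 2 = t ^ 2 := by rw [ht, div_pow, div_pow, sq_abs]
  have hM : max √2 (√2 * |θ| / s) = √2 * max 1 t := by
    rw [mul_max_of_nonneg _ _ (by positivity), mul_one, ht, mul_div_assoc]
  have hsq : ‖(⟨1, -(3 * θ / s)⟩ : ℂ)‖ ^ 2 = 1 + 9 * t ^ 2 := by
    rw [← Complex.normSq_eq_norm_sq, Complex.normSq_apply, ← hts]
    ring
  rw [hM]
  refine le_of_sq_le_sq ?_ (by positivity)
  rw [hsq]
  have hm1 : 1 ≤ max 1 t := le_max_left _ _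
  have hmt : t ≤ max 1 t := le_max_right _ _
  set m := max 1 t
  have e : ((1 + √2) * (√2 * m)) ^ 2 = (6 + 4 * √2) * m ^ 2 := by
    linear_combination (m ^ 2 * (√2 ^ 2 + 2 * √2 + 3)) * h2
  rw [e]
  nlinarith [sq_nonneg m, mul_nonneg (sub_nonneg.2 h1.le) (sq_nonneg m)]

/-- A unit in a complex cubic field and its powers, seen through the complex embedding. -/
lemma exists_conj_unit {p q : ℤ} {θ s lam : ℝ}
    (hirr : Irreducible (X ^ 3 - C (p : ℚ) * X - C (q : ℚ)))
    (hroot : θ ^ 3 - (p : ℝ) * θ - (q : ℝ) = 0)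
    (hs0 : 0 < s) (hs : s ^ 2 = 3 * θ ^ 2 - 4 * (p : ℝ)) (hlam : 0 < lam)
    (hint : IsIntegral ℤ lam) (hintinv : IsIntegral ℤ lam⁻¹) {a b c : ℕ → ℚ}
    (hcoord : ∀ n : ℕ, 1 ≤ n →
      lam ^ n = (a n : ℝ) + (b n : ℝ) * θ + (c n : ℝ) * θ ^ 2) :
    ∃ μ : ℂ, lam * Complex.normSq μ = 1 ∧ ∀ n : ℕ, 1 ≤ n →
      (c n : ℝ) * (3 * θ ^ 2 - p) = lam ^ n - (μ ^ n * (⟨1, -(3 * θ / s)⟩ : ℂ)).re := by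
  obtain ⟨σ, hσ⟩ := exists_ringHom_adjoin_root hirr hroot (conj_root_of_sq_eq hroot hs)
  set g := IntermediateField.AdjoinSimple.gen ℚ θ with hg
  have hgθ : (g : ℝ) = θ := IntermediateField.AdjoinSimple.coe_gen ℚ θ
  obtain ⟨l, hl⟩ : ∃ l : IntermediateField.adjoin ℚ {θ}, (l : ℝ) = lam := by
    refine ⟨a 1 + b 1 * g + c 1 * g ^ 2, ?_⟩
    simpa [hgθ] using (hcoord 1 le_rfl).symm
  have hpow (n : ℕ) (hn : 1 ≤ n) : σ l ^ n =
      ((a n : ℝ) : ℂ) + ((b n : ℝ) : ℂ) * (⟨-θ / 2, s / 2⟩ : ℂ)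
        + ((c n : ℝ) : ℂ) * (⟨-θ / 2, s / 2⟩ : ℂ) ^ 2 := by
    have hln : l ^ n = a n + b n * g + c n * g ^ 2 := by
      apply Subtype.ext
      simpa [hgθ, hl] using hcoord n hn
    rw [← map_pow, hln]
    simp only [map_add, map_mul, map_pow, hσ, map_ratCast, Complex.ofReal_ratCast]
  have hinj : Function.Injective (algebraMap (IntermediateField.adjoin ℚ {θ}) ℝ) :=
    (algebraMap (IntermediateField.adjoin ℚ {θ}) ℝ).injective
  have hlint : IsIntegral ℤ l := (isIntegral_algebraMap_iff hinj).mp (by simpa [hl] using hint)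
  have hlinv : IsIntegral ℤ l⁻¹ :=
    (isIntegral_algebraMap_iff hinj).mp (by simpa [hl] using hintinv)
  have hσint : IsIntegral ℤ (σ l) := hlint.map σ.toIntAlgHom
  have hσinv : IsIntegral ℤ (σ l)⁻¹ := by
    rw [← map_inv₀]; exact hlinv.map σ.toIntAlgHom
  have hl0 : l ≠ 0 := by rintro rfl; simp at hl; linarith
  have hσ0 : σ l ≠ 0 := (map_ne_zero σ).mpr hl0
  have hcplx : IsIntegral ℤ (lam : ℂ) := hint.map Complex.ofRealHom.toIntAlgHom
  have hcplxinv : IsIntegral ℤ (lam : ℂ)⁻¹ := by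
    simpa using hintinv.map Complex.ofRealHom.toIntAlgHom
  have hstar : IsIntegral ℤ ((starRingEnd ℂ) (σ l)) :=
    hσint.map (starRingEnd ℂ).toIntAlgHom
  have hstarinv : IsIntegral ℤ ((starRingEnd ℂ) (σ l))⁻¹ := by
    rw [← map_inv₀]; exact hσinv.map (starRingEnd ℂ).toIntAlgHom
  have hnorm := mul_normSq_conj_eq (a 1) (b 1) (c 1) hroot hs
  rw [← hpow 1 le_rfl, ← hcoord 1 le_rfl, pow_one, pow_one] at hnorm
  obtain ⟨r, hr⟩ : ∃ r : ℚ, lam * Complex.normSq (σ l) = r := by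
    rw [hnorm]
    refine ⟨a 1 ^ 3 + b 1 ^ 3 * q + c 1 ^ 3 * q ^ 2 + 2 * p * a 1 ^ 2 * c 1 - p * a 1 * b 1 ^ 2
      + p ^ 2 * a 1 * c 1 ^ 2 - p * q * b 1 * c 1 ^ 2 - 3 * q * a 1 * b 1 * c 1, ?_⟩
    push_cast
    ring
  have hrc : algebraMap ℚ ℂ r = lam * (σ l * (starRingEnd ℂ) (σ l)) := by
    rw [Complex.mul_conj, eq_ratCast]
    exact_mod_cast congrArg Complex.ofReal hr.symm
  have hr0 : 0 < r := by
    have : (0 : ℝ) < r := hr ▸ mul_pos hlam (Complex.normSq_pos.mpr hσ0)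
    exact_mod_cast this
  have hinjQ : Function.Injective (algebraMap ℚ ℂ) := (algebraMap ℚ ℂ).injective
  have hr1 : r = 1 := by
    refine rat_eq_one_of_isIntegral_of_isIntegral_inv hr0
      ((isIntegral_algebraMap_iff hinjQ).mp ?_) ((isIntegral_algebraMap_iff hinjQ).mp ?_)
    · rw [hrc]
      exact hcplx.mul (hσint.mul hstar)
    · rw [map_inv₀, hrc, mul_inv, mul_inv]
      exact hcplxinv.mul (hσinv.mul hstarinv)
  refine ⟨σ l, by rw [hr, hr1, Rat.cast_one], fun n hn => ?_⟩
  rw [hpow n hn, hcoord n hn]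
  exact mul_deriv_eq_sub_re _ _ _ hs0 hs

/-- **Lemma.** With the usual setup, (a) if `λ^(3n/2) > (1+√2)C₁` then `cₙ > 0`;
(b) if `λ^(3n/2) > (1+√2)C₁/(√λ(√λ - 1))` then `cₙ₊₁ > cₙ`. -/
theorem cn_positive_and_increasing
    (p q : ℤ) (θ : ℝ)
    (hirr : Irreducible (X ^ 3 - C (p : ℚ) * X - C (q : ℚ)))
    (hroot : θ ^ 3 - (p : ℝ) * θ - (q : ℝ) = 0)
    (huniq : ∀ x : ℝ, x ^ 3 - (p : ℝ) * x - (q : ℝ) = 0 → x = θ)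
    (lam : ℝ) (hlam : 1 < lam)
    (hint : IsIntegral ℤ lam) (hintinv : IsIntegral ℤ lam⁻¹)
    (a b c : ℕ → ℚ)
    (hcoord : ∀ n : ℕ, 1 ≤ n →
      lam ^ n = (a n : ℝ) + (b n : ℝ) * θ + (c n : ℝ) * θ ^ 2)
    (C₁ : ℝ)
    (hC₁ : C₁ = max (Real.sqrt 2) (Real.sqrt 2 * |θ| / Real.sqrt (3 * θ ^ 2 - 4 * (p : ℝ))))
    (n : ℕ) (hn : 1 ≤ n) :
    (lam ^ (3 * (n : ℝ) / 2) > (1 + Real.sqrt 2) * C₁ → 0 < c n) ∧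
    (lam ^ (3 * (n : ℝ) / 2)
        > (1 + Real.sqrt 2) * C₁ / (Real.sqrt lam * (Real.sqrt lam - 1)) →
      c n < c (n + 1)) := by
  have hD := discr_pos_of_unique_real_root hirr hroot huniq
  have hs : √(3 * θ ^ 2 - 4 * (p : ℝ)) ^ 2 = 3 * θ ^ 2 - 4 * p := Real.sq_sqrt hD.le
  have hs0 : 0 < √(3 * θ ^ 2 - 4 * (p : ℝ)) := Real.sqrt_pos.mpr hD
  set s := √(3 * θ ^ 2 - 4 * (p : ℝ))
  have hlam0 : 0 < lam := by linarith
  obtain ⟨μ, hμ, hc⟩ := exists_conj_unit hirr hroot hs0 hs hlam0 hint hintinv hcoord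
  have hκ := norm_interpolation_weight_le (θ := θ) hs0
  rw [← hC₁] at hκ
  set κ : ℂ := ⟨1, -(3 * θ / s)⟩
  have hF : 0 < 3 * θ ^ 2 - (p : ℝ) := by nlinarith [sq_nonneg θ]
  have hrsq : √lam ^ 2 = lam := Real.sq_sqrt hlam0.le
  have hr1 : 1 < √lam := Real.lt_sqrt_of_sq_lt (by simpa using hlam)
  have hexp : lam ^ (3 * (n : ℝ) / 2) = √lam ^ (3 * n) := by
    rw [Real.sqrt_eq_rpow, ← Real.rpow_natCast, ← Real.rpow_mul hlam0.le]
    congr 1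
    push_cast
    ring
  rw [hexp]
  set r := √lam
  have hr0 : 0 < r := by linarith
  have hμr : ‖μ‖ * r = 1 := by
    rw [Complex.normSq_eq_norm_sq, ← hrsq] at hμ
    have : (‖μ‖ * r) ^ 2 = 1 := by linear_combination hμ
    exact (pow_eq_one_iff_of_nonneg (by positivity) two_ne_zero).mp this
  have hμn : ‖μ‖ ^ n * r ^ n = 1 := by rw [← mul_pow, hμr, one_pow]
  have hpow3 : r ^ (3 * n) = lam ^ n * r ^ n := by rw [← hrsq]; ring
  have hrn : 0 < r ^ n := pow_pos hr0 n
  refine ⟨fun h => ?_, fun h => ?_⟩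
  · have hre : (μ ^ n * κ).re ≤ ‖μ‖ ^ n * ‖κ‖ := by
      simpa using Complex.re_le_norm (μ ^ n * κ)
    have hlt : ‖μ‖ ^ n * ‖κ‖ < lam ^ n := by
      refine lt_of_mul_lt_mul_right ?_ hrn.le
      calc ‖μ‖ ^ n * ‖κ‖ * r ^ n = ‖κ‖ := by linear_combination ‖κ‖ * hμn
        _ < lam ^ n * r ^ n := by rw [← hpow3]; linarith
    have : 0 < (c n : ℝ) * (3 * θ ^ 2 - p) := by rw [hc n hn]; linarith
    exact_mod_cast pos_of_mul_pos_left this hF.le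
  · have hre : ((μ ^ (n + 1) - μ ^ n) * κ).re ≤ ‖μ‖ ^ n * (‖μ‖ + 1) * ‖κ‖ := by
      refine (Complex.re_le_norm _).trans ?_
      rw [norm_mul, pow_succ, ← mul_sub_one, norm_mul, norm_pow]
      gcongr
      simpa using norm_sub_le μ 1
    have hlt : ‖μ‖ ^ n * (‖μ‖ + 1) * ‖κ‖ < lam ^ n * (lam - 1) := by
      refine lt_of_mul_lt_mul_right ?_ (mul_pos hrn hr0).le
      have hpos : 0 < r * (r - 1) := mul_pos hr0 (by linarith)
      have h' := (div_lt_iff₀ hpos).mp h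
      calc ‖μ‖ ^ n * (‖μ‖ + 1) * ‖κ‖ * (r ^ n * r) = (1 + r) * ‖κ‖ := by
            linear_combination (‖κ‖ * (‖μ‖ + 1) * r) * hμn + ‖κ‖ * hμr
        _ < (1 + r) * (r ^ (3 * n) * (r * (r - 1))) := by gcongr; linarith
        _ = lam ^ n * (lam - 1) * (r ^ n * r) := by
            rw [hpow3, ← hrsq]; ring
    have : 0 < ((c (n + 1) : ℝ) - c n) * (3 * θ ^ 2 - p) := by
      rw [sub_mul, hc n hn, hc (n + 1) (by omega)]
      rw [sub_mul, Complex.sub_re] at hre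
      have : lam ^ (n + 1) = lam ^ n * lam := pow_succ _ _
      linarith
    exact_mod_cast sub_pos.mp (pos_of_mul_pos_left this hF.le)
end
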